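/- arXiv:1610.03474 — 2 statements merged into one kernel-verified Lean document; each statement's English description precedes it below -/
import Mathlib

section
/- Let n agents have linear utilities U_i(x) = ∑_j u_{ij} x_j with ‖u_i‖₁ = 1, and let P = {x ∈ ℝ^k : x_j ≥ n^{−γ} for all j, ∑_j x_j ≤ 1} with k·n^{−γ} < 1. If x ∈ P satisfies max_{y ∈ P} ∑_i U_i(y)/U_i(x) = n, then x is a ((k−1)n^{−γ}/(1−k n^{−γ}))-approximate additive core: there is no subset S of agents and allocation z ≥ 0 with ∑_j z_j ≤ |S|/n such that U_i(z) > U_i(x) + (k−1)n^{−γ}/(1−k n^{−γ}) for all i ∈ S. -/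
/-- If `x ∈ P` satisfies `max_{y ∈ P} ∑_i U_i(y)/U_i(x) = n`, then `x` is a
`((k−1)n^{−γ}/(1−k n^{−γ}))`-approximate additive core solution. -/
theorem stmt8 (n k : ℕ) (γ : ℝ) (hγ : γ ∈ Set.Ioo (0:ℝ) 1) (hn : 0 < n)
    (u : Fin n → Fin k → ℝ) (hu : ∀ i j, 0 ≤ u i j) (hu1 : ∀ i, ∑ j, u i j = 1)
    (hk : (k : ℝ) * (n : ℝ) ^ (-γ) < 1)
    (P : Set (Fin k → ℝ))
    (hP : P = {x : Fin k → ℝ | (∀ j, (n:ℝ) ^ (-γ) ≤ x j) ∧ ∑ j, x j ≤ 1})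
    (x : Fin k → ℝ) (hx : x ∈ P)
    (hmax : ∀ y ∈ P, ∑ i, (∑ j, u i j * y j) / (∑ j, u i j * x j) ≤ (n : ℝ))
    (hmax' : ∃ y ∈ P, ∑ i, (∑ j, u i j * y j) / (∑ j, u i j * x j) = (n : ℝ)) :
    ¬ ∃ S : Finset (Fin n), S.Nonempty ∧ ∃ z : Fin k → ℝ,
      (∀ j, 0 ≤ z j) ∧ ∑ j, z j ≤ (S.card : ℝ) / n ∧
      ∀ i ∈ S, (∑ j, u i j * x j)
          + ((k:ℝ) - 1) * (n:ℝ) ^ (-γ) / (1 - (k:ℝ) * (n:ℝ) ^ (-γ))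
        < ∑ j, u i j * z j := by
  rintro ⟨S, hS, z, hz0, hz, hcore⟩
  have hnR : (0:ℝ) < n := by exact_mod_cast hn
  have hε : 0 < (n:ℝ) ^ (-γ) := Real.rpow_pos_of_pos hnR _
  generalize (n:ℝ) ^ (-γ) = ε at *
  subst hP
  obtain ⟨hx1, hx2⟩ := hx
  have hk1 : (1:ℝ) ≤ k := by
    rcases Nat.eq_zero_or_pos k with h | h
    · subst h
      have := hu1 ⟨0, hn⟩
      simp at this
    · exact_mod_cast h
  have hq : 0 < 1 - (k:ℝ) * ε := by linarith
  obtain ⟨U, hU⟩ : ∃ U : Fin n → ℝ, ∀ i, ∑ j, u i j * x j = U i := ⟨_, fun _ => rfl⟩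
  simp only [hU] at hmax hcore
  have hxle : ∀ j, x j ≤ 1 := fun j =>
    (Finset.single_le_sum (fun j _ => hε.le.trans (hx1 j)) (Finset.mem_univ j)).trans hx2
  have hUge : ∀ i, ε ≤ U i := by
    intro i
    rw [← hU]
    calc ε = ∑ j, u i j * ε := by rw [← Finset.sum_mul, hu1, one_mul]
      _ ≤ _ := Finset.sum_le_sum fun j _ => mul_le_mul_of_nonneg_left (hx1 j) (hu i j)
  have hUle : ∀ i, U i ≤ 1 := by
    intro i
    rw [← hU, ← hu1 i]
    exact Finset.sum_le_sum fun j _ => mul_le_of_le_one_right (hu i j) (hxle j)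
  have hUpos : ∀ i, 0 < U i := fun i => hε.trans_le (hUge i)
  have hinv : ∀ i, 1 ≤ (U i)⁻¹ := fun i => (one_le_inv₀ (hUpos i)).2 (hUle i)
  -- gradient bound
  have hA : ∀ j, ε * n + (1 - k * ε) * ∑ i, u i j / U i ≤ n := by
    intro j0
    have h := hmax (fun j => ε + if j = j0 then 1 - k * ε else 0) ⟨fun j => by
        dsimp only
        split_ifs <;> linarith, by
        simp [Finset.sum_add_distrib]⟩
    have e : ∀ i, (∑ j, u i j * (ε + if j = j0 then 1 - k * ε else 0)) / U i
        = ε * (U i)⁻¹ + (1 - k * ε) * (u i j0 / U i) := by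
      intro i
      simp only [mul_add, Finset.sum_add_distrib, ← Finset.sum_mul, hu1, mul_ite, mul_zero,
        Finset.sum_ite_eq', Finset.mem_univ, if_true]
      ring
    simp only [e, Finset.sum_add_distrib, ← Finset.mul_sum] at h
    have hD : (n:ℝ) ≤ ∑ i, (U i)⁻¹ := by
      calc (n:ℝ) = ∑ i : Fin n, (1:ℝ) := by simp
        _ ≤ _ := Finset.sum_le_sum fun i _ => hinv i
    have := mul_le_mul_of_nonneg_left hD hε.le
    linarith
  have hA' : ∀ j, ∑ i, u i j / U i ≤ n * (1 - ε) / (1 - k * ε) := by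
    intro j
    rw [le_div_iff₀ hq]
    linarith [hA j]
  have hε1 : ε ≤ 1 := by nlinarith
  have hM : 0 ≤ n * (1 - ε) / (1 - k * ε) :=
    div_nonneg (mul_nonneg hnR.le (by linarith)) hq.le
  have hup : ∑ i ∈ S, (∑ j, u i j * z j) / U i ≤ S.card * ((1 - ε) / (1 - k * ε)) := by
    calc ∑ i ∈ S, (∑ j, u i j * z j) / U i ≤ ∑ i, (∑ j, u i j * z j) / U i :=
          Finset.sum_le_sum_of_subset_of_nonneg (Finset.subset_univ _) fun i _ _ =>
            div_nonneg (Finset.sum_nonneg fun j _ => mul_nonneg (hu i j) (hz0 j)) (hUpos i).le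
      _ = ∑ j, (∑ i, u i j / U i) * z j := by
          simp only [Finset.sum_div, Finset.sum_mul]
          rw [Finset.sum_comm]
          refine Finset.sum_congr rfl fun j _ => Finset.sum_congr rfl fun i _ => by ring
      _ ≤ ∑ j, (n * (1 - ε) / (1 - k * ε)) * z j :=
          Finset.sum_le_sum fun j _ => mul_le_mul_of_nonneg_right (hA' j) (hz0 j)
      _ = (n * (1 - ε) / (1 - k * ε)) * ∑ j, z j := by rw [Finset.mul_sum]
      _ ≤ (n * (1 - ε) / (1 - k * ε)) * (S.card / n) := mul_le_mul_of_nonneg_left hz hM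
      _ = _ := by field_simp
  have hlow : S.card * ((1 - ε) / (1 - k * ε)) < ∑ i ∈ S, (∑ j, u i j * z j) / U i := by
    rw [← nsmul_eq_mul, ← Finset.sum_const]
    refine Finset.sum_lt_sum_of_nonempty hS fun i hi => ?_
    rw [lt_div_iff₀ (hUpos i)]
    refine lt_of_le_of_lt ?_ (hcore i hi)
    have e : (1 - ε) / (1 - k * ε) = 1 + ((k:ℝ) - 1) * ε / (1 - k * ε) := by
      rw [div_eq_iff hq.ne', add_mul, div_mul_cancel₀ _ hq.ne']
      ring
    have hα : 0 ≤ ((k:ℝ) - 1) * ε / (1 - k * ε) :=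
      div_nonneg (mul_nonneg (by linarith) hε.le) hq.le
    rw [e]
    nlinarith [mul_le_mul_of_nonneg_left (hUle i) hα]
  linarith
end

section
/- Under the same setup, if x ∈ P satisfies max_{y ∈ P} ∑_i U_i(y)/U_i(x) = n + α for some α ≥ 0, then x is a ((k−1)n^{−γ} + α n^{−1})/(1 − k n^{−γ})-approximate additive core solution. -/
/-- If `x ∈ P` satisfies `max_{y ∈ P} ∑_i U_i(y)/U_i(x) = n + α` for `α ≥ 0`, then
`x` is a `((k−1)n^{−γ} + α n^{−1})/(1 − k n^{−γ})`-approximate additive core solution. -/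
theorem stmt9 (n k : ℕ) (γ : ℝ) (hγ : γ ∈ Set.Ioo (0:ℝ) 1) (hn : 0 < n)
    (u : Fin n → Fin k → ℝ) (hu : ∀ i j, 0 ≤ u i j) (hu1 : ∀ i, ∑ j, u i j = 1)
    (hk : (k : ℝ) * (n : ℝ) ^ (-γ) < 1)
    (α : ℝ) (hα : 0 ≤ α)
    (P : Set (Fin k → ℝ))
    (hP : P = {x : Fin k → ℝ | (∀ j, (n:ℝ) ^ (-γ) ≤ x j) ∧ ∑ j, x j ≤ 1})
    (x : Fin k → ℝ) (hx : x ∈ P)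
    (hmax : ∀ y ∈ P, ∑ i, (∑ j, u i j * y j) / (∑ j, u i j * x j) ≤ (n : ℝ) + α)
    (hmax' : ∃ y ∈ P, ∑ i, (∑ j, u i j * y j) / (∑ j, u i j * x j) = (n : ℝ) + α) :
    ¬ ∃ S : Finset (Fin n), S.Nonempty ∧ ∃ z : Fin k → ℝ,
      (∀ j, 0 ≤ z j) ∧ ∑ j, z j ≤ (S.card : ℝ) / n ∧
      ∀ i ∈ S, (∑ j, u i j * x j)
          + (((k:ℝ) - 1) * (n:ℝ) ^ (-γ) + α * (n:ℝ)⁻¹) / (1 - (k:ℝ) * (n:ℝ) ^ (-γ))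
        < ∑ j, u i j * z j := by
  rintro ⟨S, hS, z, hz0, hzs, hz⟩
  have hnR : (0:ℝ) < n := by exact_mod_cast hn
  have he : 0 < (n:ℝ) ^ (-γ) := Real.rpow_pos_of_pos hnR _
  generalize (n:ℝ) ^ (-γ) = e at *
  subst hP
  obtain ⟨hxe, hxs⟩ := hx
  have hsR : (0:ℝ) < S.card := by exact_mod_cast hS.card_pos
  have hk1 : (1:ℝ) ≤ k := by
    obtain ⟨i, _⟩ := hS
    rcases Nat.eq_zero_or_pos k with h | h
    · subst h
      have := hu1 i
      simp at this
    · exact_mod_cast h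
  set M : ℝ := 1 - (k - 1) * e with hM
  set c : ℝ := 1 - k * e with hc
  have hc0 : 0 < c := by linarith
  have hMc : M = c + e := by rw [hM, hc]; ring
  have hM0 : 0 < M := by linarith
  have hM1 : M ≤ 1 := by
    have : 0 ≤ ((k:ℝ) - 1) * e := mul_nonneg (by linarith) he.le
    linarith
  have hxM : ∀ j, x j ≤ M := by
    intro j
    have h1 : ∑ j' ∈ Finset.univ.erase j, e ≤ ∑ j' ∈ Finset.univ.erase j, x j' :=
      Finset.sum_le_sum fun j' _ => hxe j'
    have h2 := Finset.add_sum_erase Finset.univ x (Finset.mem_univ j)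
    have h3 := Finset.add_sum_erase Finset.univ (fun _ : Fin k => e) (Finset.mem_univ j)
    simp only [Finset.sum_const (s := (Finset.univ : Finset (Fin k))), Finset.card_univ,
      Fintype.card_fin, nsmul_eq_mul] at h3
    rw [hM]
    linarith
  have hUM : ∀ i, ∑ j, u i j * x j ≤ M := by
    intro i
    calc ∑ j, u i j * x j ≤ ∑ j, u i j * M :=
          Finset.sum_le_sum fun j _ => mul_le_mul_of_nonneg_left (hxM j) (hu i j)
      _ = M := by rw [← Finset.sum_mul, hu1, one_mul]
  have hU0 : ∀ i, 0 < ∑ j, u i j * x j := by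
    intro i
    calc 0 < e := he
      _ = ∑ j, u i j * e := by rw [← Finset.sum_mul, hu1, one_mul]
      _ ≤ _ := Finset.sum_le_sum fun j _ => mul_le_mul_of_nonneg_left (hxe j) (hu i j)
  set t : ℝ := c * (n / S.card) with ht
  have ht0 : 0 < t := by positivity
  have hts : t * (S.card / n) = c := by rw [ht]; field_simp
  have hy := hmax (fun j => e + t * z j) ⟨fun j => by
    have := mul_nonneg ht0.le (hz0 j)
    linarith, by
    rw [Finset.sum_add_distrib, ← Finset.mul_sum]
    have := mul_le_mul_of_nonneg_left hzs ht0.le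
    simp only [Finset.sum_const, Finset.card_univ, Fintype.card_fin, nsmul_eq_mul]
    linarith⟩
  have hUy : ∀ i, ∑ j, u i j * (e + t * z j) = e + t * ∑ j, u i j * z j := by
    intro i
    rw [Finset.mul_sum]
    simp only [mul_add, Finset.sum_add_distrib]
    rw [← Finset.sum_mul, hu1, one_mul]
    congr 1
    exact Finset.sum_congr rfl fun j _ => by ring
  simp only [hUy] at hy
  set δ : ℝ := ((k - 1) * e + α * (n:ℝ)⁻¹) / c with hδ
  have hδ0 : 0 ≤ δ := by
    have : 0 ≤ ((k:ℝ) - 1) * e := mul_nonneg (by linarith) he.le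
    positivity
  have hcδ : c * δ = (k - 1) * e + α * (n:ℝ)⁻¹ := by rw [hδ]; field_simp
  have hUz0 : ∀ i, 0 ≤ ∑ j, u i j * z j := fun i =>
    Finset.sum_nonneg fun j _ => mul_nonneg (hu i j) (hz0 j)
  have hin : ∀ i ∈ S, e / M + t * (1 + δ / M)
      < (e + t * ∑ j, u i j * z j) / ∑ j, u i j * x j := by
    intro i hi
    have a1 : e / M ≤ e / ∑ j, u i j * x j := div_le_div_of_nonneg_left he.le (hU0 i) (hUM i)
    have a2 : δ / M ≤ δ / ∑ j, u i j * x j := div_le_div_of_nonneg_left hδ0 (hU0 i) (hUM i)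
    have a3 : 1 + δ / ∑ j, u i j * x j < (∑ j, u i j * z j) / ∑ j, u i j * x j := by
      rw [lt_div_iff₀ (hU0 i), add_mul, div_mul_cancel₀ _ (hU0 i).ne']
      linarith [hz i hi]
    have a4 := mul_lt_mul_of_pos_left (lt_of_le_of_lt (by linarith) a3 :
      1 + δ / M < (∑ j, u i j * z j) / ∑ j, u i j * x j) ht0
    rw [add_div, mul_div_assoc]
    linarith
  have hall : ∀ i, e / M ≤ (e + t * ∑ j, u i j * z j) / ∑ j, u i j * x j := by
    intro i
    have a1 : e / M ≤ e / ∑ j, u i j * x j := div_le_div_of_nonneg_left he.le (hU0 i) (hUM i)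
    have a2 : 0 ≤ (t * ∑ j, u i j * z j) / ∑ j, u i j * x j :=
      div_nonneg (mul_nonneg ht0.le (hUz0 i)) (hU0 i).le
    rw [add_div]
    linarith
  have hsum : ∑ i, (e / M + if i ∈ S then t * (1 + δ / M) else 0)
      < ∑ i, (e + t * ∑ j, u i j * z j) / ∑ j, u i j * x j := by
    obtain ⟨i₀, hi₀⟩ := hS
    refine Finset.sum_lt_sum (fun i _ => ?_) ⟨i₀, Finset.mem_univ _, ?_⟩
    · by_cases hi : i ∈ S
      · simpa [hi] using (hin i hi).le
      · simpa [hi] using hall i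
    · simpa [hi₀] using hin i₀ hi₀
  rw [Finset.sum_add_distrib, Finset.sum_ite_mem, Finset.univ_inter] at hsum
  simp only [Finset.sum_const, Finset.card_univ, Fintype.card_fin, nsmul_eq_mul] at hsum
  have hst : (S.card:ℝ) * (t * (1 + δ / M)) = n * (c * (1 + δ / M)) := by
    rw [ht]; field_simp
  rw [hst] at hsum
  have h1 := lt_of_lt_of_le hsum hy
  have h2 : e / M + c * (1 + δ / M) < 1 + α * (n:ℝ)⁻¹ := by
    have : (n:ℝ) * (e / M + c * (1 + δ / M)) < n * (1 + α * (n:ℝ)⁻¹) := by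
      have : (n:ℝ) * (1 + α * (n:ℝ)⁻¹) = n + α := by field_simp
      rw [this]; linarith
    exact lt_of_mul_lt_mul_left this hnR.le
  have h3 := mul_lt_mul_of_pos_right h2 hM0
  have h4 : (e / M + c * (1 + δ / M)) * M = e + c * M + c * δ := by field_simp; ring
  rw [h4, hcδ] at h3
  have h5 : 0 ≤ α * (n:ℝ)⁻¹ := by positivity
  have h6 : 0 ≤ (k:ℝ) * e := by positivity
  have h7 : c * M = M - k * e * M := by rw [hc]; ring
  have h8 := mul_nonneg (add_nonneg h5 h6) (sub_nonneg.2 hM1)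
  nlinarith
end
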